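/- arXiv:2506.06899 — 4 statements merged into one kernel-verified Lean document; each statement's English description precedes it below -/
import Mathlib

section
/- Fix η ∈ (0,1) and G > 0, and define the two-mode Gaussian kernel ψ(q_A, p_A, q_B, p_B) = exp[−(G/2)·((√(1−η)·q_A − √η·q_B)² + (√η·p_A + √(1−η)·p_B)²) − (1/(2G))·((√(1−η)·p_A − √η·p_B)² + (√η·q_A + √(1−η)·q_B)²)]. Then for every Lebesgue-integrable f : ℝ² → ℝ and every (q_B, p_B) ∈ ℝ², ∫∫∫∫_{ℝ⁴} f(q_S, p_S) · ψ( (√η·q_S + q̃)/√(1−η), (p̃ − √(1−η)·p_S)/√η, q_B + q̃/√η, p_B − p̃/√(1−η) ) dq_S dp_S dq̃ dp̃ = 2πG·η·(1−η) · ∫∫_{ℝ²} f(q_S, p_S) · exp[ −ηG·(q_S − q_B)²/2 − (1−η)G·(p_S − p_B)²/2 ] dq_S dp_S. (This is the Wigner-function integral identity underlying Theorem 1: the unconditional teleportation output is the input convolved with a Gaussian of quadrature variances 1/(ηG) and 1/((1−η)G).) -/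
open MeasureTheory Real

/-- Integrating out a measurable translate `u z` of an integrable kernel `K`. -/
lemma integral_integral_mul_translate {α : Type*} [MeasurableSpace α] {μ : Measure α} [SFinite μ]
    {H u : α → ℝ} {K : ℝ → ℝ} (hH : Integrable H μ) (hu : Measurable u) (hK : Integrable K)
    (hKm : Measurable K) :
    ∫ t : ℝ, ∫ z, H z * K (t + u z) ∂μ = (∫ t, K t) * ∫ z, H z ∂μ := by
  have hint : Integrable (Function.uncurry fun (t : ℝ) (z : α) => H z * K (t + u z))
      ((volume : Measure ℝ).prod μ) := by
    have hmeas : AEStronglyMeasurable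
        (Function.uncurry fun (t : ℝ) (z : α) => H z * K (t + u z))
        ((volume : Measure ℝ).prod μ) :=
      (hH.aestronglyMeasurable.comp_snd (μ := volume)).mul
        (hKm.comp (measurable_fst.add (hu.comp measurable_snd))).aestronglyMeasurable
    refine (integrable_prod_iff' hmeas).2
      ⟨.of_forall fun z => (hK.comp_add_right (u z)).const_mul (H z), ?_⟩
    have h : ∀ z, ∫ t : ℝ, ‖Function.uncurry (fun (t : ℝ) (z : α) => H z * K (t + u z)) (t, z)‖
        = ‖H z‖ * ∫ t, ‖K t‖ := fun z => by
      simp only [Function.uncurry_apply_pair, norm_mul, integral_const_mul]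
      rw [integral_add_right_eq_self (fun t => ‖K t‖)]
    simp only [h]
    exact hH.norm.mul_const _
  rw [integral_integral_swap hint]
  simp only [integral_const_mul, integral_add_right_eq_self K, integral_mul_const, mul_comm]

/-- Multiplying an integrable function by a Gaussian factor preserves integrability. -/
lemma MeasureTheory.Integrable.mul_exp_of_nonpos {α : Type*} [MeasurableSpace α] {μ : Measure α}
    {f g : α → ℝ} (hf : Integrable f μ) (hg : Measurable g) (hg0 : ∀ x, g x ≤ 0) :
    Integrable (fun x => f x * exp (g x)) μ :=
  hf.mul_bdd (c := 1) hg.exp.aestronglyMeasurable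
    (.of_forall fun x => by simpa [abs_of_pos (exp_pos _)] using hg0 x)

/-- Wigner-function integral identity underlying Theorem 1: with the
two-mode Gaussian kernel `ψ` of the generalized entangled resource, for every integrable
`f : ℝ² → ℝ` and every `(q_B, p_B)`, the four-fold teleportation integral (mixing, homodyne,
corrective displacement, and averaging over outcomes) equals
`2πGη(1-η)` times the convolution of `f` with a Gaussian of quadrature variances
`1/(ηG)` and `1/((1-η)G)`. -/
theorem wigner_teleportation_integral_identity
    (η G : ℝ) (hη : η ∈ Set.Ioo (0 : ℝ) 1) (hG : 0 < G)
    (f : ℝ × ℝ → ℝ) (hf : Integrable f) (qB pB : ℝ) :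
    let ψ : ℝ → ℝ → ℝ → ℝ → ℝ := fun qA pA qb pb =>
      Real.exp (-(G / 2) * ((Real.sqrt (1 - η) * qA - Real.sqrt η * qb) ^ 2 +
            (Real.sqrt η * pA + Real.sqrt (1 - η) * pb) ^ 2) -
        (1 / (2 * G)) * ((Real.sqrt (1 - η) * pA - Real.sqrt η * pb) ^ 2 +
            (Real.sqrt η * qA + Real.sqrt (1 - η) * qb) ^ 2))
    (∫ pt : ℝ, ∫ qt : ℝ, ∫ pS : ℝ, ∫ qS : ℝ,
        f (qS, pS) *
          ψ ((Real.sqrt η * qS + qt) / Real.sqrt (1 - η))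
            ((pt - Real.sqrt (1 - η) * pS) / Real.sqrt η)
            (qB + qt / Real.sqrt η) (pB - pt / Real.sqrt (1 - η))) =
      2 * Real.pi * G * η * (1 - η) *
        ∫ pS : ℝ, ∫ qS : ℝ,
          f (qS, pS) *
            Real.exp (-η * G * (qS - qB) ^ 2 / 2 - (1 - η) * G * (pS - pB) ^ 2 / 2) := by
  intro ψ
  obtain ⟨hη0, hη1⟩ := hη
  have hη1' : 0 < 1 - η := sub_pos.2 hη1
  set a := √η with ha
  set b := √(1 - η) with hb
  have ha0 : 0 < a := sqrt_pos.2 hη0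
  have hb0 : 0 < b := sqrt_pos.2 hη1'
  have ha2 : a ^ 2 = η := sq_sqrt hη0.le
  have hb2 : b ^ 2 = 1 - η := sq_sqrt hη1'.le
  have hab : a ^ 2 + b ^ 2 = 1 := by rw [ha2, hb2]; ring
  clear_value a b
  set β : ℝ := 1 / (2 * G * η * (1 - η)) with hβ
  have hβ0 : 0 < β := by positivity
  let K : ℝ → ℝ := fun x => exp (-β * x ^ 2)
  have hK : Integrable K := integrable_exp_neg_mul_sq hβ0
  have hKm : Measurable K := by fun_prop
  have hKint : (∫ t, K t) * ∫ t, K t = 2 * π * G * η * (1 - η) := by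
    have h : ∫ t, K t = √(π / β) := integral_gaussian β
    rw [h, mul_self_sqrt (by positivity), hβ]
    field_simp
  let F : ℝ × ℝ → ℝ := fun z =>
    f z * exp (-η * G * (z.1 - qB) ^ 2 / 2 - (1 - η) * G * (z.2 - pB) ^ 2 / 2)
  have hF : Integrable F := by
    refine hf.mul_exp_of_nonpos (by fun_prop) fun z => ?_
    have h1 : 0 ≤ η * G * (z.1 - qB) ^ 2 := by positivity
    have h2 : 0 ≤ (1 - η) * G * (z.2 - pB) ^ 2 := by positivity
    linarith
  let u : ℝ × ℝ → ℝ := fun z => a ^ 3 * z.1 + a * b ^ 2 * qB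
  let v : ℝ × ℝ → ℝ := fun z => -(b ^ 3 * z.2 + a ^ 2 * b * pB)
  have hu : Measurable u := by fun_prop
  have hv : Measurable v := by fun_prop
  have hFv : ∀ pt, Integrable fun z => F z * K (pt + v z) := fun pt =>
    hF.mul_exp_of_nonpos (by fun_prop) fun z => by
      have : 0 ≤ β * (pt + v z) ^ 2 := by positivity
      linarith
  have key : ∀ pt qt qS pS : ℝ,
      f (qS, pS) * ψ ((a * qS + qt) / b) ((pt - b * pS) / a) (qB + qt / a) (pB - pt / b) =
        F (qS, pS) * K (pt + v (qS, pS)) * K (qt + u (qS, pS)) := by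
    intro pt qt qS pS
    have e1 : b * ((a * qS + qt) / b) - a * (qB + qt / a) = a * (qS - qB) := by
      field_simp; ring
    have e2 : a * ((pt - b * pS) / a) + b * (pB - pt / b) = b * (pB - pS) := by
      field_simp; ring
    have e3 : b * ((pt - b * pS) / a) - a * (pB - pt / b) = (pt + v (qS, pS)) / (a * b) := by
      simp only [v]
      field_simp
      linear_combination pt * hab
    have e4 : a * ((a * qS + qt) / b) + b * (qB + qt / a) = (qt + u (qS, pS)) / (a * b) := by
      simp only [u]
      field_simp
      linear_combination qt * hab
    simp only [ψ, F, K, ← ha, ← hb, e1, e2, e3, e4]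
    rw [mul_assoc, mul_assoc, ← exp_add, ← exp_add]
    congr 2
    rw [div_pow, div_pow, mul_pow, mul_pow, mul_pow, ha2, hb2, hβ]
    field_simp
    ring
  have hprod : ∀ h : ℝ × ℝ → ℝ, Integrable h → ∫ pS, ∫ qS, h (qS, pS) = ∫ z, h z :=
    fun h hh => (integral_prod_symm h hh).symm
  have hinner : ∀ pt qt, Integrable fun z => F z * K (pt + v z) * K (qt + u z) := fun pt qt =>
    (hFv pt).mul_exp_of_nonpos (by fun_prop) fun z => by
      have : 0 ≤ β * (qt + u z) ^ 2 := by positivity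
      linarith
  simp only [key]
  calc _ = ∫ pt : ℝ, ∫ qt : ℝ, ∫ z, F z * K (pt + v z) * K (qt + u z) :=
        integral_congr_ae <| .of_forall fun pt => integral_congr_ae <| .of_forall fun qt =>
          hprod _ (hinner pt qt)
    _ = (∫ t, K t) * ((∫ t, K t) * ∫ z, F z) := by
        simp only [integral_integral_mul_translate (hFv _) hu hK hKm, integral_const_mul,
          integral_integral_mul_translate hF hv hK hKm]
    _ = _ := by rw [← mul_assoc, hKint, ← hprod F hF]
end

section
/- For every η ∈ [1/2, 1) and every G > 0, the inequality log₂(2·√(η(1−η))·G) − 1/ln 2 ≥ log₂(η/(1−η)) holds if and only if G ≥ e·√η/(2·(1−η)^{3/2}). Consequently, for η ≥ 1/2 the CV-tele-QT lower bound Q_LB exceeds the direct-transduction quantum capacity Q(L_η) = log₂(η/(1−η)) exactly when G ≥ G⋆_adv := e√η/(2(1−η)^{3/2}). -/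
/-- For every `η ∈ [1/2, 1)` and `G > 0`,
`log₂(2√(η(1-η))·G) - 1/ln 2 ≥ log₂(η/(1-η)) ↔ G ≥ e√η/(2(1-η)^{3/2})`, i.e. the
CV-tele-QT lower bound `Q_LB` exceeds the direct-transduction capacity
`Q(L_η) = log₂(η/(1-η))` exactly when `G ≥ G⋆_adv = e√η/(2(1-η)^{3/2})`. -/
theorem cv_tele_qt_advantage_threshold
    (η G : ℝ) (hη : η ∈ Set.Ico (1 / 2 : ℝ) 1) (hG : 0 < G) :
    Real.logb 2 (η / (1 - η)) ≤
        Real.logb 2 (2 * Real.sqrt (η * (1 - η)) * G) - 1 / Real.log 2 ↔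
      Real.exp 1 * Real.sqrt η / (2 * (1 - η) ^ ((3 : ℝ) / 2)) ≤ G := by
  obtain ⟨hη₁, hη₂⟩ := hη
  have hη₀ : 0 < η := by linarith
  have hη' : 0 < 1 - η := by linarith
  have hpow : (1 - η) ^ ((3 : ℝ) / 2) = √(1 - η) ^ 3 := by
    rw [Real.sqrt_eq_rpow, ← Real.rpow_natCast, ← Real.rpow_mul hη'.le]
    norm_num
  have hlog : 1 / Real.log 2 = Real.logb 2 (Real.exp 1) := by
    rw [Real.logb, Real.log_exp]
  have hs : 0 < √η := Real.sqrt_pos.2 hη₀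
  have ht : 0 < √(1 - η) := Real.sqrt_pos.2 hη'
  have he : 0 < Real.exp 1 := Real.exp_pos 1
  have hratio : η / (1 - η) = √η ^ 2 / √(1 - η) ^ 2 := by
    rw [Real.sq_sqrt hη₀.le, Real.sq_sqrt hη'.le]
  rw [hpow, hlog, hratio, Real.sqrt_mul hη₀.le, le_sub_iff_add_le]
  generalize √η = s at *
  generalize √(1 - η) = t at *
  rw [← Real.logb_mul (by positivity) he.ne',
    Real.logb_le_logb one_lt_two (by positivity) (by positivity),
    div_mul_eq_mul_div, div_le_iff₀ (by positivity), div_le_iff₀ (by positivity),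
    ← mul_le_mul_iff_right₀ hs (b := Real.exp 1 * s)]
  ring_nf
end

section
/- For every real G ≥ 4, one has (1 − √(1 − e²/G²))/2 < 1/(G + 1). That is, for squeezing gain at least 4, the minimum transduction-device efficiency required by the CV-tele-QT protocol for a positive rate, (1 − √(1 − e²/G²))/2, is strictly smaller than the threshold 1/(G+1) required by the intraband entanglement-assisted protocol of prior work. -/
/-- For every real `G ≥ 4`, `(1 - √(1 - e²/G²))/2 < 1/(G+1)`: the minimum
transduction-device efficiency required by CV-tele-QT for a positive rate is strictly
smaller than the threshold `1/(G+1)` of the intraband entanglement-assisted protocol. -/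
theorem eta_min_below_prior_threshold (G : ℝ) (hG : 4 ≤ G) :
    (1 - Real.sqrt (1 - Real.exp 1 ^ 2 / G ^ 2)) / 2 < 1 / (G + 1) := by
  have hG0 : 0 < G := by linarith
  have he : Real.exp 1 ^ 2 < 8 := by
    nlinarith [Real.exp_one_lt_d9, Real.exp_pos 1]
  have hcubic : 8 * (G + 1) ^ 2 ≤ 4 * G ^ 3 := by
    nlinarith [mul_nonneg (sub_nonneg.2 hG) (sq_nonneg G)]
  have hdiv : Real.exp 1 ^ 2 / G ^ 2 < 4 * G / (G + 1) ^ 2 := by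
    rw [div_lt_div_iff₀ (by positivity) (by positivity)]
    have := mul_lt_mul_of_pos_right he (show 0 < (G + 1) ^ 2 by positivity)
    linarith
  have hsq : ((G - 1) / (G + 1)) ^ 2 = 1 - 4 * G / (G + 1) ^ 2 := by
    field_simp
    ring
  have hsqrt : (G - 1) / (G + 1) < Real.sqrt (1 - Real.exp 1 ^ 2 / G ^ 2) := by
    apply Real.lt_sqrt_of_sq_lt
    linarith
  have hsub : (G - 1) / (G + 1) = 1 - 2 * (1 / (G + 1)) := by
    field_simp
    ring
  linarith
end

section
/- Fix η ∈ (0,1) and G > 0. Let X and Y be independent real random variables with X ~ N(0, 1/(ηG)) and Y ~ N(0, 1/((1−η)G)). Then the probability that the pair (X,Y) falls outside the rectangle [−√(2π)·((1−η)/η)^{1/4}, √(2π)·((1−η)/η)^{1/4}] × [−√(2π)·(η/(1−η))^{1/4}, √(2π)·(η/(1−η))^{1/4}] is at most 2·exp(−π·√(η(1−η))·G). (This gives the GKP logical error probability bound P_E ≤ 1 − Erf[√(Gπ)(η(1−η))^{1/4}]² ≤ 2·exp(−√(η(1−η))·G·π).) -/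
open MeasureTheory ProbabilityTheory

/-- Where `m` and `x` have opposite signs, recentring a Gaussian density from `0` to `m` costs a
factor `exp (-m² / (2v))`. -/
lemma gaussianPDF_le_exp_mul_gaussianPDF_zero {m x : ℝ} (v : NNReal) (h : m * x ≤ 0) :
    gaussianPDF m v x ≤ ENNReal.ofReal (Real.exp (-m ^ 2 / (2 * v))) * gaussianPDF 0 v x := by
  rw [gaussianPDF, gaussianPDF, ← ENNReal.ofReal_mul (Real.exp_nonneg _)]
  apply ENNReal.ofReal_le_ofReal
  rw [gaussianPDFReal, gaussianPDFReal, mul_left_comm, ← Real.exp_add, ← add_div]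
  gcongr
  nlinarith

lemma gaussianReal_le_exp_mul_gaussianReal_zero {m : ℝ} {v : NNReal} (hv : v ≠ 0) {s : Set ℝ}
    (hs : MeasurableSet s) (h : ∀ x ∈ s, m * x ≤ 0) :
    gaussianReal m v s ≤ ENNReal.ofReal (Real.exp (-m ^ 2 / (2 * v))) * gaussianReal 0 v s := by
  rw [gaussianReal_apply _ hv, gaussianReal_apply _ hv,
    ← lintegral_const_mul _ (measurable_gaussianPDF 0 v)]
  exact setLIntegral_mono' hs fun x hx => gaussianPDF_le_exp_mul_gaussianPDF_zero v (h x hx)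

/-- Two-sided tail bound for a centred Gaussian, without a factor `2`. -/
lemma gaussianReal_zero_compl_Icc_le {a : ℝ} (ha : 0 ≤ a) {v : NNReal} (hv : v ≠ 0) :
    gaussianReal 0 v (Set.Icc (-a) a)ᶜ ≤ ENNReal.ofReal (Real.exp (-a ^ 2 / (2 * v))) := by
  have hright : gaussianReal 0 v (Set.Ioi a) = gaussianReal (-a) v (Set.Ioi 0) := by
    rw [← zero_sub a, ← gaussianReal_map_sub_const a,
      Measure.map_apply (by fun_prop) measurableSet_Ioi]
    simp
  have hleft : gaussianReal 0 v (Set.Iio (-a)) = gaussianReal a v (Set.Iio 0) := by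
    have hmap := gaussianReal_map_add_const (μ := 0) (v := v) a
    rw [zero_add] at hmap
    rw [← hmap, Measure.map_apply (by fun_prop) measurableSet_Iio]
    simp
  have hcompl : (Set.Icc (-a) a)ᶜ = Set.Iio (-a) ∪ Set.Ioi a := by
    ext x
    simp [imp_iff_not_or]
  have hdisj : Disjoint (Set.Iio (0 : ℝ)) (Set.Ioi 0) :=
    Set.disjoint_left.2 fun _ h₁ h₂ => lt_asymm (Set.mem_Iio.1 h₁) (Set.mem_Ioi.1 h₂)
  calc gaussianReal 0 v (Set.Icc (-a) a)ᶜ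
      ≤ gaussianReal a v (Set.Iio 0) + gaussianReal (-a) v (Set.Ioi 0) := by
        rw [hcompl, ← hleft, ← hright]
        exact measure_union_le _ _
    _ ≤ ENNReal.ofReal (Real.exp (-a ^ 2 / (2 * v))) * gaussianReal 0 v (Set.Iio 0) +
          ENNReal.ofReal (Real.exp (-a ^ 2 / (2 * v))) * gaussianReal 0 v (Set.Ioi 0) := by
        refine add_le_add (gaussianReal_le_exp_mul_gaussianReal_zero hv measurableSet_Iio
          fun x hx => mul_nonpos_of_nonneg_of_nonpos ha (le_of_lt hx)) ?_
        rw [← neg_sq a]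
        exact gaussianReal_le_exp_mul_gaussianReal_zero hv measurableSet_Ioi
          fun x hx => mul_nonpos_of_nonpos_of_nonneg (neg_nonpos.2 ha) (le_of_lt hx)
    _ = ENNReal.ofReal (Real.exp (-a ^ 2 / (2 * v))) *
          gaussianReal 0 v (Set.Iio 0 ∪ Set.Ioi 0) := by
        rw [measure_union hdisj measurableSet_Ioi, mul_add]
    _ ≤ ENNReal.ofReal (Real.exp (-a ^ 2 / (2 * v))) := mul_le_of_le_one_right' prob_le_one

/-- The tail bound at the half-width `√(2π) (q/p)^(1/4)` of a rectangular GKP cell, for noise of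
variance `1 / (pG)`. -/
lemma gaussianReal_compl_gkp_interval_le {p q G : ℝ} (hp : 0 < p) (hq : 0 < q) (hG : 0 < G) :
    gaussianReal 0 (Real.toNNReal (1 / (p * G)))
        (Set.Icc (-(Real.sqrt (2 * Real.pi) * (q / p) ^ ((1 : ℝ) / 4)))
          (Real.sqrt (2 * Real.pi) * (q / p) ^ ((1 : ℝ) / 4)))ᶜ ≤
      ENNReal.ofReal (Real.exp (-Real.pi * Real.sqrt (p * q) * G)) := by
  have hvar : 0 < 1 / (p * G) := by positivity
  refine (gaussianReal_zero_compl_Icc_le (by positivity) (Real.toNNReal_pos.2 hvar).ne').trans_eq ?_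
  have hrpow : ((q / p) ^ ((1 : ℝ) / 4)) ^ 2 = Real.sqrt (q / p) := by
    rw [← Real.rpow_natCast, ← Real.rpow_mul (by positivity), Real.sqrt_eq_rpow]
    norm_num
  have hsqrt : Real.sqrt (p * q) = p * Real.sqrt (q / p) := by
    rw [show p * q = p ^ 2 * (q / p) by field_simp, Real.sqrt_mul (sq_nonneg p),
      Real.sqrt_sq hp.le]
  rw [Real.coe_toNNReal _ hvar.le, mul_pow, hrpow, Real.sq_sqrt (by positivity), hsqrt]
  congr 2
  field_simp

/-- for independent `X ~ N(0, 1/(ηG))` and `Y ~ N(0, 1/((1-η)G))`, the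
probability that `(X,Y)` falls outside the correctable GKP rectangle
`[-√(2π)((1-η)/η)^{1/4}, √(2π)((1-η)/η)^{1/4}] × [-√(2π)(η/(1-η))^{1/4}, √(2π)(η/(1-η))^{1/4}]`
is at most `2·exp(-π√(η(1-η))·G)`. -/
theorem gkp_logical_error_probability_bound
    {Ω : Type*} [MeasureSpace Ω] [IsProbabilityMeasure (ℙ : Measure Ω)]
    (η G : ℝ) (hη : η ∈ Set.Ioo (0 : ℝ) 1) (hG : 0 < G)
    (X Y : Ω → ℝ) (hmX : Measurable X) (hmY : Measurable Y)
    (hX : Measure.map X ℙ = gaussianReal 0 (Real.toNNReal (1 / (η * G))))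
    (hY : Measure.map Y ℙ = gaussianReal 0 (Real.toNNReal (1 / ((1 - η) * G))))
    (hXY : IndepFun X Y ℙ) :
    ℙ {ω | (X ω, Y ω) ∉
        Set.Icc (-(Real.sqrt (2 * Real.pi) * ((1 - η) / η) ^ ((1 : ℝ) / 4)))
            (Real.sqrt (2 * Real.pi) * ((1 - η) / η) ^ ((1 : ℝ) / 4)) ×ˢ
          Set.Icc (-(Real.sqrt (2 * Real.pi) * (η / (1 - η)) ^ ((1 : ℝ) / 4)))
            (Real.sqrt (2 * Real.pi) * (η / (1 - η)) ^ ((1 : ℝ) / 4))} ≤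
      ENNReal.ofReal (2 * Real.exp (-Real.pi * Real.sqrt (η * (1 - η)) * G)) := by
  have hη₁ : 0 < 1 - η := sub_pos.2 hη.2
  have hXtail := gaussianReal_compl_gkp_interval_le hη.1 hη₁ hG
  have hYtail := gaussianReal_compl_gkp_interval_le hη₁ hη.1 hG
  rw [← hX, Measure.map_apply hmX measurableSet_Icc.compl] at hXtail
  rw [← hY, Measure.map_apply hmY measurableSet_Icc.compl, mul_comm (1 - η) η] at hYtail
  rw [two_mul (Real.exp _), ENNReal.ofReal_add (Real.exp_nonneg _) (Real.exp_nonneg _)]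
  refine (measure_mono ?_).trans ((measure_union_le _ _).trans (add_le_add hXtail hYtail))
  intro ω hω
  rwa [Set.mem_ofPred_eq, Set.mem_prod, not_and_or] at hω
end
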